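/- Let 1 ≤ m ≤ k. Every partition belonging to L^k(m,n) belongs to L^{k+1}(m,n), and for any λ, μ ∈ L^k(m,n), μ ≼ λ in the k-Young order if and only if μ ≼ λ in the (k+1)-Young order. Hence L^k(m,n) is an induced subposet of L^{k+1}(m,n). -/

import Mathlib

/-- A partition: a weakly decreasing list of positive integers. -/
def IsPartition (l : List ℕ) : Prop :=
  l.Pairwise (· ≥ ·) ∧ ∀ x ∈ l, 0 < x

/-- The `i`-th part (0-indexed), with parts beyond the length equal to 0. -/
def part (l : List ℕ) (i : ℕ) : ℕ := l.getD i 0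

/-- Diagram containment `l ⊆ m`: every part of `l` is at most the corresponding part of `m`. -/
def SubDiag (l m : List ℕ) : Prop := ∀ i, part l i ≤ part m i

/-- A `k`-bounded partition: a partition whose first part is at most `k`. -/
def KBounded (k : ℕ) (l : List ℕ) : Prop := IsPartition l ∧ part l 0 ≤ k

/-- Hook length of the square `(i,j)` (0-indexed) with respect to the skew diagram
`outer/inner`: the number of cells `(i,j')` of the skew diagram with `j' ≥ j` plus the
number of cells `(i',j)` of the skew diagram with `i' > i`. -/
def hookLen (outer inner : List ℕ) (i j : ℕ) : ℕ :=
  ((Finset.range (part outer i)).filter (fun j' => j ≤ j' ∧ part inner i ≤ j')).card +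
  ((Finset.range outer.length).filter
    (fun i' => i < i' ∧ part inner i' ≤ j ∧ j < part outer i')).card

/-- `(outer, inner)` is the `k`-skew diagram of the `k`-bounded partition `l`:
row `i` of `outer/inner` has `l i` cells, every cell of `outer/inner` has hook length
at most `k`, and every square of the inner shape has hook length exceeding `k`. -/
def IsKSkew (k : ℕ) (l outer inner : List ℕ) : Prop :=
  IsPartition outer ∧ IsPartition inner ∧ SubDiag inner outer ∧
  (∀ i, part outer i - part inner i = part l i) ∧
  (∀ i j, part inner i ≤ j → j < part outer i → hookLen outer inner i j ≤ k) ∧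
  (∀ i j, j < part inner i → k < hookLen outer inner i j)

/-- Length of column `j` of the skew diagram `outer/inner`. -/
def colLen (outer inner : List ℕ) (j : ℕ) : ℕ :=
  ((Finset.range outer.length).filter
    (fun i => part inner i ≤ j ∧ j < part outer i)).card

/-- The list of column lengths of the skew diagram `outer/inner`. -/
def skewCols (outer inner : List ℕ) : List ℕ :=
  ((List.range (part outer 0)).map (colLen outer inner)).filter (fun x => decide (x ≠ 0))

/-- The `k`-conjugate of `l`: the partition whose parts are the column lengths of the
(unique) `k`-skew diagram of `l`. -/
noncomputable def kConj (k : ℕ) (l : List ℕ) : List ℕ :=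
  haveI := Classical.dec (∃ p : List ℕ × List ℕ, IsKSkew k l p.1 p.2)
  if h : ∃ p : List ℕ × List ℕ, IsKSkew k l p.1 p.2 then
    skewCols h.choose.1 h.choose.2
  else []

/-- The covering relation of the `k`-Young order on `k`-bounded partitions. -/
def KCover (k : ℕ) (l m : List ℕ) : Prop :=
  KBounded k l ∧ KBounded k m ∧ SubDiag l m ∧
  SubDiag (kConj k l) (kConj k m) ∧ m.sum = l.sum + 1

/-- The `k`-Young order: reflexive-transitive closure of the covering relation. -/
def KLe (k : ℕ) : List ℕ → List ℕ → Prop := Relation.ReflTransGen (KCover k)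

/-- The weakly decreasing rearrangement of the combined parts of two partitions. -/
def punion (l r : List ℕ) : List ℕ := (l ++ r).mergeSort (fun a b => decide (a ≥ b))

/-- The ordinary conjugate of a partition: the list of column lengths of its diagram. -/
def conj (l : List ℕ) : List ℕ :=
  (List.range (part l 0)).map (fun j => (l.filter (fun x => decide (j < x))).length)

@[simp] theorem part_nil (i : ℕ) : part [] i = 0 := rfl

@[simp] theorem part_cons_zero (a : ℕ) (l : List ℕ) : part (a :: l) 0 = a := rfl

@[simp] theorem part_cons_succ (a : ℕ) (l : List ℕ) (i : ℕ) :
    part (a :: l) (i + 1) = part l i := rfl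

@[simp] theorem part_tail (l : List ℕ) (i : ℕ) : part l.tail i = part l (i + 1) := by
  cases l <;> rfl

theorem part_eq_zero_of_length_le {l : List ℕ} {i : ℕ} (h : l.length ≤ i) : part l i = 0 := by
  simp [part, List.getD_eq_getElem?_getD, List.getElem?_eq_none h]

theorem part_replicate (n m i : ℕ) : part (List.replicate n m) i = if i < n then m else 0 := by
  by_cases h : i < n <;> simp [part, List.getD_eq_getElem?_getD, h]

theorem isPartition_nil : IsPartition [] := by simp [IsPartition]

theorem isPartition_cons {a : ℕ} {l : List ℕ} :
    IsPartition (a :: l) ↔ part l 0 ≤ a ∧ 0 < a ∧ IsPartition l := by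
  constructor
  · rintro ⟨h1, h2⟩
    rw [List.pairwise_cons] at h1
    refine ⟨?_, h2 a (by simp), h1.2, fun x hx => h2 x (by simp [hx])⟩
    cases l with
    | nil => simp
    | cons b l => exact h1.1 b (by simp)
  · rintro ⟨h1, h2, h3, h4⟩
    refine ⟨List.pairwise_cons.2 ⟨fun x hx => ?_, h3⟩, ?_⟩
    · cases l with
      | nil => simp at hx
      | cons b l =>
        rcases List.mem_cons.1 hx with rfl | hx
        · exact h1
        · exact le_trans ((List.pairwise_cons.1 h3).1 x hx) h1
    · intro x hx
      rcases List.mem_cons.1 hx with rfl | hx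
      · exact h2
      · exact h4 x hx

theorem IsPartition.tail {l : List ℕ} (h : IsPartition l) : IsPartition l.tail := by
  cases l with
  | nil => exact h
  | cons a l => exact (isPartition_cons.1 h).2.2

theorem IsPartition.part_antitone {l : List ℕ} (h : IsPartition l) : Antitone (part l) := by
  refine antitone_nat_of_succ_le fun i => ?_
  induction l generalizing i with
  | nil => simp
  | cons a l ih =>
    rw [isPartition_cons] at h
    cases i with
    | zero => exact h.1
    | succ i => exact ih h.2.2 i

theorem IsPartition.length_le {l : List ℕ} (h : IsPartition l) {i : ℕ} (hi : part l i = 0) :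
    l.length ≤ i := by
  induction l generalizing i with
  | nil => simp
  | cons a l ih =>
    rw [isPartition_cons] at h
    cases i with
    | zero => simp at hi; omega
    | succ i =>
      have := ih h.2.2 (i := i) hi
      simpa using this

theorem IsPartition.ext {l l' : List ℕ} (h : IsPartition l) (h' : IsPartition l')
    (hp : ∀ i, part l i = part l' i) : l = l' := by
  induction l generalizing l' with
  | nil =>
    have := h'.length_le (i := 0) (hp 0).symm
    exact (List.length_eq_zero_iff.1 (by omega)).symm
  | cons a l ih =>
    cases l' with
    | nil =>
      have := h.length_le (i := 0) (hp 0)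
      simp at this
    | cons b l' =>
      rw [isPartition_cons] at h h'
      rw [show a = b from hp 0, ih h.2.2 h'.2.2 fun i => hp (i + 1)]

theorem sum_eq_sum_part (l : List ℕ) : l.sum = ∑ i ∈ Finset.range l.length, part l i := by
  induction l with
  | nil => simp
  | cons a l ih => simp [Finset.sum_range_succ', ih, add_comm]

/-- The list of nonzero values of `f` below `N`. -/
def nonzeroValues (f : ℕ → ℕ) (N : ℕ) : List ℕ :=
  ((List.range N).map f).filter (fun x => decide (x ≠ 0))

theorem nonzeroValues_succ (f : ℕ → ℕ) (N : ℕ) (h : f 0 ≠ 0) :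
    nonzeroValues f (N + 1) = f 0 :: nonzeroValues (fun i => f (i + 1)) N := by
  simp [nonzeroValues, List.range_succ_eq_map, h, Function.comp_def]

theorem nonzeroValues_eq_nil {f : ℕ → ℕ} (hf : Antitone f) (N : ℕ) (h : f 0 = 0) :
    nonzeroValues f N = [] := by
  have h0 : ∀ i, f i = 0 := fun i => Nat.eq_zero_of_le_zero (h ▸ hf (Nat.zero_le i))
  simp [nonzeroValues, h0]

theorem part_nonzeroValues {f : ℕ → ℕ} (hf : Antitone f) {N : ℕ} (hN : f N = 0) (i : ℕ) :
    part (nonzeroValues f N) i = f i := by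
  by_cases h : f 0 = 0
  · rw [nonzeroValues_eq_nil hf N h]
    exact (Nat.eq_zero_of_le_zero (h ▸ hf (Nat.zero_le i))).symm
  · induction N generalizing f i with
    | zero => exact absurd hN h
    | succ N ih =>
      rw [nonzeroValues_succ f N h]
      cases i with
      | zero => rfl
      | succ i =>
        have hf' : Antitone fun i => f (i + 1) := fun a b hab => hf (by omega)
        by_cases h1 : f (0 + 1) = 0
        · rw [nonzeroValues_eq_nil hf' N h1]
          exact (Nat.eq_zero_of_le_zero (h1 ▸ hf (by omega))).symm
        · exact ih hf' hN i h1

theorem isPartition_nonzeroValues {f : ℕ → ℕ} (hf : Antitone f) (N : ℕ) :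
    IsPartition (nonzeroValues f N) := by
  refine ⟨List.Pairwise.filter _ ?_, fun x hx => ?_⟩
  · rw [List.pairwise_map]
    exact List.pairwise_lt_range.imp fun h => hf h.le
  · simp [nonzeroValues] at hx
    omega

theorem sum_nonzeroValues (f : ℕ → ℕ) (N : ℕ) :
    (nonzeroValues f N).sum = ∑ i ∈ Finset.range N, f i := by
  induction N with
  | zero => simp [nonzeroValues]
  | succ N ih =>
    rw [Finset.sum_range_succ, ← ih]
    by_cases h : f N = 0 <;> simp [nonzeroValues, List.range_succ, h]

theorem colLen_cons (o : ℕ) (os is : List ℕ) (j : ℕ) :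
    colLen (o :: os) is j =
      colLen os is.tail j + if part is 0 ≤ j ∧ j < o then 1 else 0 := by
  simp [colLen, Finset.card_filter, Finset.sum_range_succ', -Finset.sum_boole]
  rfl

theorem hookLen_cons_zero (o : ℕ) (os is : List ℕ) (j : ℕ) :
    hookLen (o :: os) is 0 j = (o - max j (part is 0)) + colLen os is.tail j := by
  have h : (Finset.range o).filter (fun j' => j ≤ j' ∧ part is 0 ≤ j') =
      Finset.Ico (max j (part is 0)) o := by
    ext x
    simp
    omega
  simp [hookLen, h, colLen, Finset.card_filter, Finset.sum_range_succ', -Finset.sum_boole]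

theorem hookLen_cons_succ (o : ℕ) (os is : List ℕ) (i j : ℕ) :
    hookLen (o :: os) is (i + 1) j = hookLen os is.tail i j := by
  simp [hookLen, Finset.card_filter, Finset.sum_range_succ', -Finset.sum_boole]

/-- The first column of height at most `k - r`. -/
noncomputable def firstFit (k r : ℕ) (c : ℕ → ℕ) : ℕ := sInf {i | c i + r ≤ k}

/-- The column lengths of the `k`-skew diagram of `l`, built row by row: a new row of length `r`
starts at the first column that leaves all hook lengths at most `k`. -/
noncomputable def kCol (k : ℕ) : List ℕ → ℕ → ℕ
  | [], _ => 0
  | r :: l, j => kCol k l j +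
      if firstFit k r (kCol k l) ≤ j ∧ j < firstFit k r (kCol k l) + r then 1 else 0

theorem kCol_cons (k r : ℕ) (l : List ℕ) (j : ℕ) :
    kCol k (r :: l) j =
      kCol k l j + if firstFit k r (kCol k l) ≤ j ∧ j < firstFit k r (kCol k l) + r then 1 else 0 := rfl

theorem kCol_eventually_zero (k : ℕ) (l : List ℕ) : ∃ N, ∀ j, N ≤ j → kCol k l j = 0 := by
  induction l with
  | nil => exact ⟨0, fun _ _ => rfl⟩
  | cons r l ih =>
    obtain ⟨N, hN⟩ := ih
    refine ⟨max N (firstFit k r (kCol k l) + r), fun j hj => ?_⟩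
    rw [kCol_cons, hN j (by omega), if_neg (by omega)]

theorem kCol_firstFit_add_le {k r : ℕ} (hr : r ≤ k) (l : List ℕ) : kCol k l (firstFit k r (kCol k l)) + r ≤ k := by
  obtain ⟨N, hN⟩ := kCol_eventually_zero k l
  exact Nat.sInf_mem (s := {i | kCol k l i + r ≤ k}) ⟨N, by simp [hN N le_rfl, hr]⟩

theorem lt_of_lt_firstFit {k r : ℕ} {l : List ℕ} {j : ℕ} (hj : j < firstFit k r (kCol k l)) :
    k < kCol k l j + r :=
  not_le.1 (Nat.notMem_of_lt_sInf (s := {i | kCol k l i + r ≤ k}) hj)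

theorem firstFit_le {k r : ℕ} {l : List ℕ} {j : ℕ} (hj : kCol k l j + r ≤ k) : firstFit k r (kCol k l) ≤ j :=
  Nat.sInf_le hj

theorem kCol_antitone {k : ℕ} {l : List ℕ} (hl : ∀ x ∈ l, x ≤ k) : Antitone (kCol k l) := by
  induction l with
  | nil => exact fun _ _ _ => le_rfl
  | cons r l ih =>
    have ih := ih fun x hx => hl x (by simp [hx])
    have hs := kCol_firstFit_add_le (hl r (by simp)) l
    intro i j hij
    have h1 := ih hij
    rw [kCol_cons, kCol_cons]
    by_cases hi : i < firstFit k r (kCol k l)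
    · have h2 := lt_of_lt_firstFit hi
      by_cases hj : j < firstFit k r (kCol k l)
      · rw [if_neg (by omega), if_neg (by omega)]
        omega
      · have h3 := ih (not_lt.1 hj)
        split_ifs <;> omega
    · split_ifs <;> omega

theorem KBounded.le {k : ℕ} {l : List ℕ} (h : KBounded k l) : ∀ x ∈ l, x ≤ k := by
  intro x hx
  obtain ⟨i, hi, rfl⟩ := List.getElem_of_mem hx
  have := h.1.part_antitone (Nat.zero_le i)
  have h2 : part l i = l[i] := by simp [part, hi]
  exact h2 ▸ this.trans h.2

theorem KBounded.of_cons {k r : ℕ} {l : List ℕ} (h : KBounded k (r :: l)) : KBounded k l :=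
  ⟨h.1.tail, (isPartition_cons.1 h.1).1.trans h.2⟩

theorem IsKSkew.tail {k r o : ℕ} {l os is : List ℕ} (h : IsKSkew k (r :: l) (o :: os) is) :
    IsKSkew k l os is.tail := by
  obtain ⟨h1, h2, h3, h4, h5, h6⟩ := h
  refine ⟨h1.tail, h2.tail, fun i => ?_, fun i => ?_, fun i j hi hj => ?_, fun i j hj => ?_⟩
  · simpa using h3 (i + 1)
  · simpa using h4 (i + 1)
  · rw [← hookLen_cons_succ o]
    exact h5 (i + 1) j (by simpa using hi) hj
  · rw [← hookLen_cons_succ o]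
    exact h6 (i + 1) j (by simpa using hj)

theorem IsKSkew.colLen_eq {k : ℕ} {l outer inner : List ℕ} (hb : KBounded k l)
    (h : IsKSkew k l outer inner) (j : ℕ) : colLen outer inner j = kCol k l j := by
  induction l generalizing outer inner j with
  | nil =>
    rw [colLen, Finset.filter_false_of_mem]
    · rfl
    · intro i _
      have := h.2.2.2.1 i
      simp at this
      omega
  | cons r l ih =>
    have hl := isPartition_cons.1 hb.1
    cases outer with
    | nil =>
      have := h.2.2.2.1 0
      simp at this
      omega
    | cons o os =>
      have hc := fun j => ih hb.of_cons h.tail j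
      have hrow : o - part inner 0 = r := h.2.2.2.1 0
      have hstart : part inner 0 = firstFit k r (kCol k l) := by
        refine le_antisymm (not_lt.1 fun hlt => ?_) (firstFit_le ?_)
        · have h1 := h.2.2.2.2.2 0 _ hlt
          have h2 := kCol_firstFit_add_le hb.2 l
          rw [hookLen_cons_zero, hc] at h1
          simp only [part_cons_zero] at h2
          omega
        · have h1 := h.2.2.2.2.1 0 _ le_rfl (by simp only [part_cons_zero]; omega)
          rw [hookLen_cons_zero, hc] at h1
          omega
      rw [colLen_cons, hc, kCol_cons, hstart]
      congr 2
      have : o = firstFit k r (kCol k l) + r := by omega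
      rw [this]

theorem KBounded.exists_isKSkew {k : ℕ} {l : List ℕ} (hb : KBounded k l) :
    ∃ outer inner, IsKSkew k l outer inner := by
  induction l with
  | nil => exact ⟨[], [], isPartition_nil, isPartition_nil, by simp [SubDiag]⟩
  | cons r l ih =>
    obtain ⟨os, is, hsk⟩ := ih hb.of_cons
    have hc := hsk.colLen_eq hb.of_cons
    obtain ⟨ho, hi, hsub, hrow, hcell, hsq⟩ := hsk
    have hl := isPartition_cons.1 hb.1
    have hrk : r ≤ k := hb.2
    have hr0 := hrow 0
    have hfit := kCol_firstFit_add_le hrk l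
    set s := firstFit k r (kCol k l) with hs
    have his : part is 0 ≤ s := by
      by_contra! hlt
      have h1 := hsq 0 s hlt
      cases os with
      | nil =>
        have := hsub 0
        simp at this
        omega
      | cons o os =>
        rw [hookLen_cons_zero] at h1
        have h2 := hc s
        rw [colLen_cons] at h2
        simp only [part_cons_zero] at hr0
        omega
    obtain ⟨inner, hinner, hin0, htail⟩ :
        ∃ inner, IsPartition inner ∧ part inner 0 = s ∧ inner.tail = is := by
      rcases Nat.eq_zero_or_pos s with h0 | h0
      · have := hi.length_le (i := 0) (by omega)
        have hnil : is = [] := List.length_eq_zero_iff.1 (by omega)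
        exact ⟨[], isPartition_nil, h0.symm, hnil.symm⟩
      · exact ⟨s :: is, isPartition_cons.2 ⟨his, h0, hi⟩, rfl, rfl⟩
    have hsucc : ∀ i, part inner (i + 1) = part is i := fun i => by rw [← htail, part_tail]
    have hos : part os 0 ≤ s + r := by
      have := hsub 0
      omega
    refine ⟨(s + r) :: os, inner, isPartition_cons.2 ⟨hos, by omega, ho⟩, hinner, ?_, ?_, ?_, ?_⟩
    · rintro (_ | i)
      · simp [hin0]
      · simpa [hsucc] using hsub i
    · rintro (_ | i)
      · simp [hin0]
      · simpa [hsucc] using hrow i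
    · rintro (_ | i) j h1 h2
      · rw [hookLen_cons_zero, htail, hc, hin0]
        rw [hin0] at h1
        have := kCol_antitone hb.of_cons.le h1
        omega
      · rw [hookLen_cons_succ, htail]
        exact hcell i j (by rwa [← hsucc]) h2
    · rintro (_ | i) j h1
      · rw [hin0] at h1
        rw [hookLen_cons_zero, htail, hc, hin0]
        have := lt_of_lt_firstFit h1
        omega
      · rw [hookLen_cons_succ, htail]
        exact hsq i j (by rwa [← hsucc])

theorem colLen_eq_zero {outer inner : List ℕ} (ho : IsPartition outer) {j : ℕ}
    (hj : part outer 0 ≤ j) : colLen outer inner j = 0 := by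
  rw [colLen, Finset.filter_false_of_mem, Finset.card_empty]
  intro i _
  have := ho.part_antitone (Nat.zero_le i)
  omega

theorem KBounded.part_kConj {k : ℕ} {l : List ℕ} (hb : KBounded k l) (j : ℕ) :
    part (kConj k l) j = kCol k l j := by
  have hex : ∃ p : List ℕ × List ℕ, IsKSkew k l p.1 p.2 := by
    obtain ⟨o, i, h⟩ := hb.exists_isKSkew
    exact ⟨(o, i), h⟩
  have hsk := hex.choose_spec
  have hcol : colLen hex.choose.1 hex.choose.2 = kCol k l := funext (hsk.colLen_eq hb)
  rw [kConj, dif_pos hex]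
  change part (nonzeroValues (colLen hex.choose.1 hex.choose.2) (part hex.choose.1 0)) j = _
  rw [part_nonzeroValues (hcol ▸ kCol_antitone hb.le) (colLen_eq_zero hsk.1 le_rfl), hcol]

/-- The number of parts of `l` larger than `i`. -/
def colCount (l : List ℕ) (i : ℕ) : ℕ := (l.filter (fun x => decide (i < x))).length

theorem colCount_cons (a : ℕ) (l : List ℕ) (i : ℕ) :
    colCount (a :: l) i = colCount l i + if i < a then 1 else 0 := by
  by_cases h : i < a <;> simp [colCount, h]

theorem colCount_le_length (l : List ℕ) (i : ℕ) : colCount l i ≤ l.length :=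
  List.length_filter_le _ _

theorem colCount_mono {l l' : List ℕ} (h : SubDiag l l') (i : ℕ) :
    colCount l i ≤ colCount l' i := by
  induction l generalizing l' with
  | nil => simp [colCount]
  | cons a l ih =>
    have h0 := h 0
    have h1 : SubDiag l l'.tail := fun t => by simpa using h (t + 1)
    have h2 := ih h1
    rw [colCount_cons]
    cases l' with
    | nil =>
      simp at h0
      simpa [h0] using h2
    | cons b l' =>
      rw [colCount_cons]
      simp only [part_cons_zero, List.tail_cons] at h0 h2
      split_ifs <;> omega

/-- At most `p` rows of `l` are shorter than `m`. -/
def FewShortRows (m p : ℕ) (l : List ℕ) : Prop := ∀ i, part l i < m → part l (i + p) = 0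

theorem FewShortRows.of_cons {m p a : ℕ} {l : List ℕ} (h : FewShortRows m p (a :: l)) :
    FewShortRows m p l := fun i hi => by
  have := h (i + 1) (by simpa using hi)
  rwa [Nat.add_right_comm, part_cons_succ] at this

/-- Each residue class of columns modulo `m` is filled from left to right in stacks of height
`p`. -/
theorem kCol_eq_min {k m p : ℕ} (hm : 1 ≤ m) (hp : 1 ≤ p) (hk : k + 1 = p + m) {l : List ℕ}
    (hl : IsPartition l) (hlm : part l 0 ≤ m) (hs : FewShortRows m p l) (j : ℕ) :
    kCol k l j = min p (colCount l (j % m) - (j / m) * p) := by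
  induction l generalizing j with
  | nil => simp [kCol, colCount]
  | cons r l ih =>
    have hl' := isPartition_cons.1 hl
    have ih := ih hl'.2.2 (hl'.1.trans hlm) hs.of_cons
    have hbd : KBounded k (r :: l) := ⟨hl, hlm.trans (by omega)⟩
    have hr : r ≤ m := hlm
    have hjm : j % m < m := Nat.mod_lt j hm
    rw [kCol_cons, colCount_cons]
    rcases hr.lt_or_eq with hrm | rfl
    · have hlen : l.length + 1 ≤ p := by
        have := hs 0 hrm
        rw [Nat.zero_add] at this
        simpa using hl.length_le this
      have hcount := colCount_le_length l (j % m)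
      have h0 : firstFit k r (kCol k l) = 0 := by
        have := colCount_le_length l 0
        refine Nat.le_zero.1 (firstFit_le ?_)
        rw [ih 0, Nat.zero_mod, Nat.zero_div, Nat.zero_mul]
        omega
      rw [h0, ih j]
      rcases Nat.lt_or_ge j m with hj | hj
      · rw [Nat.mod_eq_of_lt hj] at hcount ⊢
        rw [Nat.div_eq_of_lt hj, Nat.zero_mul]
        split_ifs <;> omega
      · have h1 : 1 ≤ j / m := (Nat.one_le_div_iff hm).2 hj
        have h2 : p ≤ (j / m) * p := Nat.le_mul_of_pos_left p h1
        split_ifs <;> omega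
    · have hanti := kCol_antitone hbd.of_cons.le
      have hfit := kCol_firstFit_add_le (show r ≤ k by omega) l
      have hlt := fun i (hi : i < firstFit k r (kCol k l)) => lt_of_lt_firstFit hi
      set s := firstFit k r (kCol k l) with hs
      rw [if_pos hjm]
      have hshift : r ≤ j → kCol k l (j - r) =
          min p (colCount l (j % r) - (j / r - 1) * p) ∧ (j / r) * p = (j / r - 1) * p + p := by
        intro hj
        have h1 : 1 ≤ j / r := (Nat.one_le_div_iff hm).2 hj
        refine ⟨?_, ?_⟩
        · rw [ih, ← Nat.mod_eq_sub_mod hj, Nat.div_eq_sub_div hm hj,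
            Nat.add_sub_cancel]
        · rw [← Nat.succ_mul, Nat.succ_eq_add_one, Nat.sub_add_cancel h1]
      have hsmall : j < r → (j / r) * p = 0 := fun hj => by
        rw [Nat.div_eq_of_lt hj, Nat.zero_mul]
      have hj := ih j
      rcases Nat.lt_or_ge j s with h1 | h1
      · have := hlt j h1
        rw [if_neg (by omega)]
        omega
      · have h2 := hanti h1
        rcases Nat.lt_or_ge j (s + r) with h3 | h3
        · rw [if_pos ⟨h1, h3⟩]
          rcases Nat.lt_or_ge j r with h4 | h4
          · have := hsmall h4
            omega
          · have h5 := hlt (j - r) (by omega)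
            have h6 := hshift h4
            omega
        · rw [if_neg (by omega)]
          have h5 := hanti (show s ≤ j - r by omega)
          have h6 := hshift (by omega)
          omega

theorem kCol_le_kCol_cons (k r : ℕ) (l : List ℕ) (j : ℕ) : kCol k l j ≤ kCol k (r :: l) j :=
  Nat.le_add_right _ _

theorem lt_kCol_zero {k m p : ℕ} (hk : k + 1 = p + m) {l : List ℕ} (hl : IsPartition l) {i t : ℕ}
    (ht : t ≤ p) (hi : part l i < m) (hit : 0 < part l (i + t)) : t < kCol k l 0 := by
  induction l generalizing i t with
  | nil => simp at hit
  | cons r l ih =>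
    have hl' := isPartition_cons.1 hl
    cases i with
    | succ i =>
      rw [Nat.add_right_comm, part_cons_succ] at hit
      exact (ih hl'.2.2 ht hi hit).trans_le (kCol_le_kCol_cons k r l 0)
    | zero =>
      have hr : r < m := hi
      have hlow : t ≤ kCol k l 0 := by
        cases t with
        | zero => exact Nat.zero_le _
        | succ t =>
          rw [Nat.zero_add, part_cons_succ] at hit
          exact ih hl'.2.2 (by omega) (hl'.1.trans_lt hr) (by rwa [Nat.zero_add])
      by_cases hfull : kCol k l 0 + r ≤ k
      · have h0 := Nat.le_zero.1 (firstFit_le hfull)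
        rw [kCol_cons, h0, if_pos ⟨le_rfl, by omega⟩]
        omega
      · have := kCol_le_kCol_cons k r l 0
        omega

theorem fewShortRows_of_kCol_le {k m p : ℕ} (hk : k + 1 = p + m) {l : List ℕ}
    (hl : IsPartition l) (h : kCol k l 0 ≤ p) : FewShortRows m p l := by
  intro i hi
  by_contra hne
  exact absurd (lt_kCol_zero hk hl le_rfl hi (Nat.pos_of_ne_zero hne)) (not_lt.2 h)

/-- The partitions contained in `(m^n)` with at most `p` rows shorter than `m`. -/
def InRect (m n p : ℕ) (l : List ℕ) : Prop :=
  IsPartition l ∧ SubDiag l (List.replicate n m) ∧ FewShortRows m p l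

theorem SubDiag.trans {a b c : List ℕ} (h : SubDiag a b) (h' : SubDiag b c) : SubDiag a c :=
  fun i => (h i).trans (h' i)

theorem InRect.part_le {m n p : ℕ} {l : List ℕ} (h : InRect m n p l) (i : ℕ) : part l i ≤ m := by
  have := h.2.1 i
  rw [part_replicate] at this
  split_ifs at this <;> omega

theorem InRect.kBounded {k m n p : ℕ} {l : List ℕ} (h : InRect m n p l) (hmk : m ≤ k) :
    KBounded k l :=
  ⟨h.1, (h.part_le 0).trans hmk⟩

theorem InRect.mono {m n p q : ℕ} {l : List ℕ} (h : InRect m n p l) (hpq : p ≤ q) :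
    InRect m n q l :=
  ⟨h.1, h.2.1, fun i hi =>
    Nat.eq_zero_of_le_zero (h.2.2 i hi ▸ h.1.part_antitone (Nat.add_le_add_left hpq i))⟩

theorem inRect_replicate {m n p : ℕ} (hm : 1 ≤ m) : InRect m n p (List.replicate n m) := by
  refine ⟨⟨List.pairwise_replicate.2 (Or.inr le_rfl), fun x hx => ?_⟩, fun _ => le_rfl, ?_⟩
  · rw [List.eq_of_mem_replicate hx]
    exact hm
  · intro i hi
    rw [part_replicate] at hi ⊢
    split_ifs at hi with h
    · omega
    · rw [if_neg (by omega)]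

theorem InRect.of_kCover {k m n p : ℕ} (hm : 1 ≤ m) (hp : 1 ≤ p) (hk : k + 1 = p + m)
    {a b : List ℕ} (hb : InRect m n p b) (h : KCover k a b) : InRect m n p a := by
  obtain ⟨ha, hb', hsub, hconj, -⟩ := h
  refine ⟨ha.1, hsub.trans hb.2.1, fewShortRows_of_kCol_le hk ha.1 ?_⟩
  rw [← ha.part_kConj]
  refine (hconj 0).trans ?_
  rw [hb'.part_kConj, kCol_eq_min hm hp hk hb.1 (hb.part_le 0) hb.2.2]
  exact min_le_left _ _

theorem InRect.of_kLe {k m n p : ℕ} (hm : 1 ≤ m) (hp : 1 ≤ p) (hk : k + 1 = p + m)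
    {a b : List ℕ} (hb : InRect m n p b) (h : KLe k a b) : InRect m n p a := by
  induction h using Relation.ReflTransGen.head_induction_on with
  | refl => exact hb
  | head h _ ih => exact ih.of_kCover hm hp hk h

theorem KLe.subDiag {k : ℕ} {a b : List ℕ} (h : KLe k a b) : SubDiag a b := by
  induction h with
  | refl => exact fun _ => le_rfl
  | tail _ h ih => exact ih.trans h.2.2.1

theorem InRect.kCover {k m n p : ℕ} (hm : 1 ≤ m) (hp : 1 ≤ p) (hk : k + 1 = p + m)
    {a b : List ℕ} (ha : InRect m n p a) (hb : InRect m n p b) (hsub : SubDiag a b)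
    (hsum : b.sum = a.sum + 1) : KCover k a b := by
  have ha' := ha.kBounded (k := k) (by omega)
  have hb' := hb.kBounded (k := k) (by omega)
  refine ⟨ha', hb', hsub, fun j => ?_, hsum⟩
  rw [ha'.part_kConj, hb'.part_kConj, kCol_eq_min hm hp hk ha.1 (ha.part_le 0) ha.2.2,
    kCol_eq_min hm hp hk hb.1 (hb.part_le 0) hb.2.2]
  exact min_le_min_left _ (Nat.sub_le_sub_right (colCount_mono hsub _) _)

theorem exists_last_part_lt {a b : List ℕ} (ha : IsPartition a) (hb : IsPartition b)
    (hsub : SubDiag a b) (hne : a ≠ b) :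
    ∃ i, part a i < part b i ∧ ∀ t, i < t → part a t = part b t := by
  obtain ⟨i, hi⟩ : ∃ i, part a i < part b i := by
    by_contra! h
    exact hne (ha.ext hb fun i => le_antisymm (hsub i) (h i))
  have hlen : ∀ t, part a t < part b t → t ≤ b.length := fun t ht => by
    by_contra! h
    rw [part_eq_zero_of_length_le h.le] at ht
    omega
  refine ⟨Nat.findGreatest (fun t => part a t < part b t) b.length,
    Nat.findGreatest_spec (P := fun t => part a t < part b t) (hlen i hi) hi, fun t ht => ?_⟩
  refine le_antisymm (hsub t) (not_lt.1 fun hlt => ?_)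
  exact absurd (Nat.le_findGreatest (P := fun t => part a t < part b t) (hlen t hlt) hlt)
    (not_le.2 ht)

theorem InRect.exists_remove_cell {m n p : ℕ} (hp : 1 ≤ p) {a b : List ℕ} (ha : InRect m n p a)
    (hb : InRect m n p b) (hsub : SubDiag a b) (hne : a ≠ b) :
    ∃ c, InRect m n p c ∧ SubDiag a c ∧ SubDiag c b ∧ b.sum = c.sum + 1 := by
  obtain ⟨i, hi, hlast⟩ := exists_last_part_lt ha.1 hb.1 hsub hne
  have hanti : Antitone fun t => part b t - if t = i then 1 else 0 := by
    refine antitone_nat_of_succ_le fun t => ?_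
    have h1 := hb.1.part_antitone (Nat.le_succ t)
    have h2 := ha.1.part_antitone (Nat.le_succ t)
    simp only [Nat.succ_eq_add_one] at h1 h2
    by_cases ht : t = i
    · subst ht
      have := hlast (t + 1) (by omega)
      simp
      omega
    · simp only [if_neg ht]
      omega
  have hc := part_nonzeroValues hanti (N := b.length)
    (by simp [part_eq_zero_of_length_le (le_refl b.length)])
  have hcp := isPartition_nonzeroValues hanti b.length
  have hcs := sum_nonzeroValues (fun t => part b t - if t = i then 1 else 0) b.length
  set c := nonzeroValues (fun t => part b t - if t = i then 1 else 0) b.length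
  have hcb : SubDiag c b := fun t => (hc t).trans_le (Nat.sub_le _ _)
  refine ⟨c, ⟨hcp, hcb.trans hb.2.1, fun t ht => ?_⟩, fun t => ?_, hcb, ?_⟩
  · rw [hc] at ht
    have hle := hcb (t + p)
    by_cases hti : t = i
    · subst hti
      have h1 := hlast (t + p) (by omega)
      have h2 := ha.2.2 t (by have := hb.part_le t; omega)
      omega
    · rw [if_neg hti] at ht
      have := hb.2.2 t ht
      omega
  · rw [hc]
    have := hsub t
    by_cases hti : t = i
    · subst hti
      rw [if_pos rfl]
      omega
    · rw [if_neg hti]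
      omega
  · have hib : i < b.length := by
      by_contra! h
      rw [part_eq_zero_of_length_le h] at hi
      omega
    rw [hcs, sum_eq_sum_part b,
      ← Finset.add_sum_erase _ (part b) (Finset.mem_range.2 hib),
      ← Finset.add_sum_erase _ (fun t => part b t - if t = i then 1 else 0)
        (Finset.mem_range.2 hib)]
    have hrest : ∑ t ∈ (Finset.range b.length).erase i, (part b t - if t = i then 1 else 0) =
        ∑ t ∈ (Finset.range b.length).erase i, part b t :=
      Finset.sum_congr rfl fun t ht => by simp [Finset.ne_of_mem_erase ht]
    rw [hrest]
    simp only [if_true]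
    omega

theorem InRect.kLe {k m n p : ℕ} (hm : 1 ≤ m) (hp : 1 ≤ p) (hk : k + 1 = p + m)
    {a b : List ℕ} (ha : InRect m n p a) (hb : InRect m n p b) (hsub : SubDiag a b) :
    KLe k a b := by
  induction hN : b.sum generalizing b with
  | zero =>
    by_cases hne : a = b
    · exact hne ▸ Relation.ReflTransGen.refl
    · obtain ⟨c, -, -, -, hsum⟩ := ha.exists_remove_cell hp hb hsub hne
      omega
  | succ N ih =>
    by_cases hne : a = b
    · exact hne ▸ Relation.ReflTransGen.refl
    · obtain ⟨c, hc, hac, hcb, hsum⟩ := ha.exists_remove_cell hp hb hsub hne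
      exact (ih hc hac (by omega)).tail (hc.kCover hm hp hk hb hcb hsum)

/-- `L^k(m,n)` is an induced subposet of `L^{k+1}(m,n)`: every element of
`L^k(m,n)` lies in `L^{k+1}(m,n)`, and on `L^k(m,n)` the `k`-Young order and the
`(k+1)`-Young order agree. -/
theorem kIdeal_induced_in_succ (k m n : ℕ) (hm : 1 ≤ m) (hmk : m ≤ k) :
    (∀ μ, KLe k μ (List.replicate n m) → KLe (k + 1) μ (List.replicate n m)) ∧
    (∀ lam μ, KLe k lam (List.replicate n m) → KLe k μ (List.replicate n m) →
      (KLe k μ lam ↔ KLe (k + 1) μ lam)) := by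
  obtain ⟨p, hp, hk⟩ : ∃ p, 1 ≤ p ∧ k + 1 = p + m := ⟨k + 1 - m, by omega, by omega⟩
  have hk' : k + 1 + 1 = (p + 1) + m := by omega
  have hp' : 1 ≤ p + 1 := by omega
  have hmem : ∀ μ, KLe k μ (List.replicate n m) → InRect m n p μ :=
    fun μ h => (inRect_replicate hm).of_kLe hm hp hk h
  have hup : ∀ μ, InRect m n p μ → InRect m n (p + 1) μ := fun μ h => h.mono (Nat.le_succ p)
  refine ⟨fun μ h => ?_, fun lam μ hlam hmu => ⟨fun h => ?_, fun h => ?_⟩⟩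
  · exact (hup μ (hmem μ h)).kLe hm hp' hk' (inRect_replicate hm) (hmem μ h).2.1
  · exact (hup μ (hmem μ hmu)).kLe hm hp' hk' (hup lam (hmem lam hlam)) h.subDiag
  · exact (hmem μ hmu).kLe hm hp hk (hmem lam hlam) h.subDiag
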